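/- arXiv:2112.13766 — 3 statements merged into one kernel-verified Lean document; each statement's English description precedes it below -/
import Mathlib

section
/- For every integer m ≥ 2, the central binomial coefficient C(2m, m) does not divide C(4m, 2m). -/
/-- When `n < p ^ 2`, the `p`-adic valuation of `n.choose k` is read off from a single quotient
in Legendre's formula. -/
theorem factorization_choose_add_div {p n k : ℕ} (hp : p.Prime) (hn : n < p ^ 2) (hk : k ≤ n) :
    (n.choose k).factorization p + k / p + (n - k) / p = n / p := by
  have key : ∀ a ≤ n, a.factorial.factorization p = a / p := fun a ha => by
    have hlog : Nat.log p a < 2 := by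
      rcases Nat.eq_zero_or_pos a with rfl | h
      · simp
      · exact Nat.log_lt_of_lt_pow h.ne' (ha.trans_lt hn)
    simp [Nat.factorization_factorial hp hlog]
  have h := congrArg (fun x => x.factorization p) (Nat.choose_mul_factorial_mul_factorial hk)
  rw [Nat.factorization_mul (mul_ne_zero (Nat.choose_pos hk).ne' (by positivity)) (by positivity),
    Nat.factorization_mul (Nat.choose_pos hk).ne' (by positivity)] at h
  simpa [key _ hk, key _ (Nat.sub_le n k), key _ le_rfl] using h

/-- A prime in `(4m/3, 2m]` divides `C(2m, m)` but not `C(4m, 2m)`. -/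
theorem not_choose_dvd_choose_of_prime {m p : ℕ} (hm : 2 ≤ m) (hp : p.Prime) (h1 : 4 * m < 3 * p)
    (h2 : p ≤ 2 * m) : ¬ (Nat.choose (2 * m) m ∣ Nat.choose (4 * m) (2 * m)) := by
  intro hdvd
  have hp3 : 3 ≤ p := by omega
  have hsq : 4 * m < p ^ 2 := by nlinarith
  have hle := (Nat.factorization_prime_le_iff_dvd (Nat.choose_pos (by omega)).ne'
    (Nat.choose_pos (by omega)).ne').2 hdvd p hp
  have e1 := factorization_choose_add_div (k := m) hp (show 2 * m < p ^ 2 by omega) (by omega)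
  have e2 := factorization_choose_add_div (k := 2 * m) hp hsq (by omega)
  have d1 : m / p = 0 := Nat.div_eq_of_lt (by omega)
  have d2 : 2 * m / p = 1 := Nat.div_eq_of_lt_le (by omega) (by omega)
  have d4 : 4 * m / p = 2 := Nat.div_eq_of_lt_le (by omega) (by omega)
  rw [show 2 * m - m = m by omega, d1, d2] at e1
  rw [show 4 * m - 2 * m = 2 * m by omega, d2, d4] at e2
  omega

theorem six_mul_div_add_div_le (q : ℕ) {p : ℕ} (hp : 0 < p) :
    6 * q / p + q / p ≤ 3 * q / p + 2 * (2 * q / p) + 1 := by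
  obtain ⟨a, r, hr, rfl⟩ : ∃ a r, r < p ∧ q = r + p * a :=
    ⟨q / p, q % p, Nat.mod_lt _ hp, (Nat.mod_add_div q p).symm⟩
  have h : ∀ k, k * (r + p * a) / p = k * r / p + k * a := fun k => by
    rw [← Nat.add_mul_div_left _ _ hp]; congr 1; ring
  have h1 := h 1
  simp only [one_mul] at h1
  rw [h, h1, h, h, Nat.div_eq_of_lt hr]
  have h6 : 6 * r / p < 6 := Nat.div_lt_of_lt_mul (by omega)
  have l6 := Nat.div_mul_le_self (6 * r) p
  have l3 := Nat.lt_div_mul_add (a := 3 * r) hp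
  have l2 := Nat.lt_div_mul_add (a := 2 * r) hp
  generalize 6 * r / p = e6 at *
  generalize 3 * r / p = e3 at *
  generalize 2 * r / p = e2 at *
  by_contra! hc
  have h3 : e3 < 6 := by omega
  have h2 : e2 < 6 := by omega
  interval_cases e6 <;> interval_cases e3 <;> interval_cases e2 <;> omega

theorem six_mul_div_le {q p : ℕ} (hqp : q < p) (h : p ≤ 2 * q ∨ 2 * q + 1 < p ∧ p ≤ 4 * q) :
    6 * q / p ≤ 3 * q / p + 4 * q / p := by
  have hp : 0 < p := by omega
  have h6 : 6 * q / p < 6 := Nat.div_lt_of_lt_mul (by omega)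
  have l6 := Nat.div_mul_le_self (6 * q) p
  have l3 := Nat.lt_div_mul_add (a := 3 * q) hp
  have l4 := Nat.lt_div_mul_add (a := 4 * q) hp
  generalize 6 * q / p = e6 at *
  generalize 3 * q / p = e3 at *
  generalize 4 * q / p = e4 at *
  by_contra! hc
  have h3 : e3 < 6 := by omega
  have h2 : e4 < 6 := by omega
  interval_cases e6 <;> interval_cases e3 <;> interval_cases e4 <;> omega

/-- If there is no prime in `(4q + 2, 6q]`, then `(6q)! q! / ((3q)! (2q)! ^ 2)` is essentially a
divisor of `C(4q, 2q)` times the product of the primes up to `q`. -/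
theorem choose_mul_choose_dvd {q : ℕ} (hq : 0 < q)
    (hno : ∀ p, p.Prime → 4 * q + 2 < p → 6 * q < p) :
    (6 * q).choose (3 * q) * (3 * q).choose q ∣
      (2 * q).choose q * (4 * q).choose (2 * q) * ((4 * q + 1) * (2 * q + 1)) * primorial q *
        ∏ p ∈ Finset.range (Nat.sqrt (6 * q) + 1) with p.Prime, p ^ (2 * Nat.log p (6 * q)) := by
  set S := ∏ p ∈ Finset.range (Nat.sqrt (6 * q) + 1) with p.Prime, p ^ (2 * Nat.log p (6 * q))
    with hS
  have c6 : (6 * q).choose (3 * q) ≠ 0 := (Nat.choose_pos (by omega)).ne'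
  have c3 : (3 * q).choose q ≠ 0 := (Nat.choose_pos (by omega)).ne'
  have c2 : (2 * q).choose q ≠ 0 := (Nat.choose_pos (by omega)).ne'
  have c4 : (4 * q).choose (2 * q) ≠ 0 := (Nat.choose_pos (by omega)).ne'
  have hP : primorial q ≠ 0 := (primorial_pos q).ne'
  have hS0 : S ≠ 0 := Finset.prod_ne_zero_iff.2 fun p hp =>
    pow_ne_zero _ (Finset.mem_filter.1 hp).2.ne_zero
  refine (Nat.factorization_prime_le_iff_dvd (by positivity) (by positivity)).1 fun p hp => ?_
  rw [Nat.factorization_mul c6 c3, Nat.factorization_mul (by positivity) hS0,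
    Nat.factorization_mul (by positivity) hP, Nat.factorization_mul (by positivity) (by positivity),
    Nat.factorization_mul c2 c4, Nat.factorization_mul (by positivity) (by positivity)]
  simp only [Finsupp.add_apply]
  rcases le_or_gt (p ^ 2) (6 * q) with hsm | hlg
  · have hpS : 2 * Nat.log p (6 * q) ≤ S.factorization p :=
      (hp.pow_dvd_iff_le_factorization hS0).1 <| Finset.dvd_prod_of_mem
        (fun p => p ^ (2 * Nat.log p (6 * q))) (Finset.mem_filter.2
          ⟨Finset.mem_range.2 (Nat.lt_succ_of_le (Nat.le_sqrt'.2 hsm)), hp⟩)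
    have h6 : ((6 * q).choose (3 * q)).factorization p ≤ Nat.log p (6 * q) :=
      Nat.factorization_choose_le_log
    have h3 : ((3 * q).choose q).factorization p ≤ Nat.log p (3 * q) :=
      Nat.factorization_choose_le_log
    have hlog : Nat.log p (3 * q) ≤ Nat.log p (6 * q) := Nat.log_mono_right (by omega)
    omega
  · have v6 := factorization_choose_add_div (k := 3 * q) hp hlg (by omega)
    have v3 := factorization_choose_add_div (n := 3 * q) (k := q) hp (by omega) (by omega)
    have v2 := factorization_choose_add_div (n := 2 * q) (k := q) hp (by omega) (by omega)
    have v4 := factorization_choose_add_div (n := 4 * q) (k := 2 * q) hp (by omega) (by omega)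
    rw [show 6 * q - 3 * q = 3 * q by omega] at v6
    rw [show 3 * q - q = 2 * q by omega] at v3
    rw [show 2 * q - q = q by omega] at v2
    rw [show 4 * q - 2 * q = 2 * q by omega] at v4
    rcases le_or_gt p q with hpq | hpq
    · have hd : p ∣ primorial q := Finset.dvd_prod_of_mem (fun p => p)
        (Finset.mem_filter.2 ⟨Finset.mem_range.2 (Nat.lt_succ_of_le hpq), hp⟩)
      have := hp.factorization_pos_of_dvd hP hd
      have := six_mul_div_add_div_le q hp.pos
      omega
    · have d1 : q / p = 0 := Nat.div_eq_of_lt hpq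
      have hp3 : 3 ≤ p := by
        by_contra! h
        have : p ^ 2 ≤ 2 ^ 2 := Nat.pow_le_pow_left (by omega) 2
        omega
      by_cases hr : p ≤ 2 * q ∨ 2 * q + 1 < p ∧ p ≤ 4 * q
      · have := six_mul_div_le hpq hr
        omega
      · rcases le_or_gt p (4 * q + 2) with h42 | h42
        · have hne : p ≠ 4 * q + 2 := by
            rintro rfl
            rcases hp.eq_one_or_self_of_dvd 2 ⟨2 * q + 1, by ring⟩ with h | h <;> omega
          rcases (show p = 2 * q + 1 ∨ p = 4 * q + 1 by omega) with h | h
          · have hf : 0 < (2 * q + 1).factorization p :=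
              hp.factorization_pos_of_dvd (by omega) (by rw [h])
            have d6 : 6 * q / p = 2 := Nat.div_eq_of_lt_le (by omega) (by omega)
            have d4 : 4 * q / p = 1 := Nat.div_eq_of_lt_le (by omega) (by omega)
            omega
          · have hf : 0 < (4 * q + 1).factorization p :=
              hp.factorization_pos_of_dvd (by omega) (by rw [h])
            have d6 : 6 * q / p = 1 := Nat.div_eq_of_lt_le (by omega) (by omega)
            omega
        · have d6 : 6 * q / p = 0 := Nat.div_eq_of_lt (hno p hp h42)
          omega

theorem prod_prime_pow_two_mul_log_le {n : ℕ} (hn : 0 < n) (s : ℕ) :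
    ∏ p ∈ Finset.range (s + 1) with p.Prime, p ^ (2 * Nat.log p n) ≤ n ^ (2 * s) := by
  calc _ ≤ ∏ p ∈ Finset.range (s + 1) with p.Prime, n ^ 2 := Finset.prod_le_prod' fun p _ => by
        rw [mul_comm, pow_mul]
        exact Nat.pow_le_pow_left (Nat.pow_log_le_self p hn.ne') 2
    _ = (n ^ 2) ^ (Finset.card {p ∈ Finset.range (s + 1) | p.Prime}) := Finset.prod_const _
    _ ≤ (n ^ 2) ^ s := by
        refine Nat.pow_le_pow_right (by positivity) ?_
        have hsub : {p ∈ Finset.range (s + 1) | p.Prime} ⊆ Finset.Icc 1 s := fun p hp => by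
          simp only [Finset.mem_filter, Finset.mem_range, Finset.mem_Icc] at hp ⊢
          exact ⟨hp.2.one_le, by omega⟩
        simpa using Finset.card_le_card hsub
    _ = n ^ (2 * s) := (pow_mul n 2 s).symm

theorem pow_le_mul_choose_three_mul {q : ℕ} (hq : 0 < q) :
    27 ^ q ≤ 3 * q * 4 ^ q * (3 * q).choose q := by
  induction q, hq using Nat.le_induction with
  | base => decide
  | succ n hn ih =>
    have f0 := Nat.choose_mul_factorial_mul_factorial (show n ≤ 3 * n by omega)
    have f1 := Nat.choose_mul_factorial_mul_factorial (show n + 1 ≤ 3 * (n + 1) by omega)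
    rw [show 3 * n - n = 2 * n by omega] at f0
    rw [show 3 * (n + 1) - (n + 1) = 2 * n + 1 + 1 by omega,
      show 3 * (n + 1) = 3 * n + 1 + 1 + 1 by ring] at f1
    simp only [Nat.factorial_succ] at f1
    rw [← f0] at f1
    have hF : 0 < n.factorial * (2 * n).factorial * (n + 1) := by positivity
    have hrec : (3 * (n + 1)).choose (n + 1) * (2 * (2 * n + 1) * (n + 1)) =
        3 * (3 * n + 2) * (3 * n + 1) * (3 * n).choose n := by
      refine Nat.eq_of_mul_eq_mul_left hF ?_
      rw [show 3 * (n + 1) = 3 * n + 1 + 1 + 1 by ring]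
      linear_combination f1
    refine Nat.le_of_mul_le_mul_right ?_ (show 0 < 2 * (2 * n + 1) * (n + 1) by positivity)
    calc 27 ^ (n + 1) * (2 * (2 * n + 1) * (n + 1))
        = 27 ^ n * (54 * (2 * n + 1) * (n + 1)) := by ring
      _ ≤ (3 * n * 4 ^ n * (3 * n).choose n) * (54 * (2 * n + 1) * (n + 1)) := by gcongr
      _ = (3 * (n + 1) * 4 ^ n * (3 * n).choose n) * (54 * n * (2 * n + 1)) := by ring
      _ ≤ (3 * (n + 1) * 4 ^ n * (3 * n).choose n) * (12 * (3 * n + 2) * (3 * n + 1)) := by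
        refine Nat.mul_le_mul_left _ ?_
        nlinarith
      _ = 3 * (n + 1) * 4 ^ (n + 1) * (3 * (3 * n + 2) * (3 * n + 1) * (3 * n).choose n) := by ring
      _ = _ := by rw [← hrec]; ring

/-- If there is no prime in `(4q + 2, 6q]`, then `q` cannot be large. -/
theorem pow_le_of_forall_prime {q : ℕ} (hq : 0 < q)
    (hno : ∀ p, p.Prime → 4 * q + 2 < p → 6 * q < p) :
    27 ^ q ≤ 16 ^ q * (6 * q) ^ (2 * Nat.sqrt (6 * q) + 4) := by
  have c2 : 0 < (2 * q).choose q := Nat.choose_pos (by omega)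
  have c4 : 0 < (4 * q).choose (2 * q) := Nat.choose_pos (by omega)
  have hpos : 0 < ∏ p ∈ Finset.range (Nat.sqrt (6 * q) + 1) with p.Prime,
      p ^ (2 * Nat.log p (6 * q)) :=
    Finset.prod_pos fun p hp => pow_pos (Finset.mem_filter.1 hp).2.pos _
  have hle := Nat.le_of_dvd (by have := primorial_pos q; positivity) (choose_mul_choose_dvd hq hno)
  have u2 : (2 * q).choose q ≤ 4 ^ q := by
    simpa [pow_mul] using Nat.choose_le_two_pow (2 * q) q
  have u4 : (4 * q).choose (2 * q) ≤ 16 ^ q := by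
    simpa [pow_mul] using Nat.choose_le_two_pow (4 * q) (2 * q)
  have uS := prod_prime_pow_two_mul_log_le (show 0 < 6 * q by omega) (Nat.sqrt (6 * q))
  have l6 : 64 ^ q ≤ 6 * q * (6 * q).choose (3 * q) := by
    have := Nat.four_pow_le_two_mul_self_mul_centralBinom (3 * q) (by omega)
    rw [Nat.centralBinom, pow_mul, ← mul_assoc] at this
    norm_num only at this
    exact this
  have l3 := pow_le_mul_choose_three_mul hq
  refine Nat.le_of_mul_le_mul_left ?_ (show 0 < 64 ^ q by positivity)
  calc 64 ^ q * 27 ^ q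
      ≤ (6 * q * (6 * q).choose (3 * q)) * (3 * q * 4 ^ q * (3 * q).choose q) := by gcongr
    _ = 18 * q ^ 2 * 4 ^ q * ((6 * q).choose (3 * q) * (3 * q).choose q) := by ring
    _ ≤ 18 * q ^ 2 * 4 ^ q * (4 ^ q * 16 ^ q * ((4 * q + 1) * (2 * q + 1)) * 4 ^ q *
          (6 * q) ^ (2 * Nat.sqrt (6 * q))) := by
        refine Nat.mul_le_mul_left _ (hle.trans ?_)
        gcongr
        exact primorial_le_four_pow q
    _ = (4 * 4 * 4 : ℕ) ^ q * (16 ^ q * ((18 * q ^ 2 * ((4 * q + 1) * (2 * q + 1))) *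
          (6 * q) ^ (2 * Nat.sqrt (6 * q)))) := by rw [mul_pow (4 * 4) 4, mul_pow 4 4]; ring
    _ ≤ 64 ^ q * (16 ^ q * ((6 * q) ^ 4 * (6 * q) ^ (2 * Nat.sqrt (6 * q)))) := by
        norm_num only
        gcongr
        have : (4 * q + 1) * (2 * q + 1) ≤ 15 * q ^ 2 := by nlinarith
        nlinarith [Nat.mul_le_mul_left (18 * q ^ 2) this, pow_pos hq 4]
    _ = _ := by ring

/-- Bertrand's postulate with ratio close to `3 / 2`. -/
theorem exists_prime_of_large {q : ℕ} (hq : 15000 ≤ q) :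
    ∃ p, p.Prime ∧ 4 * q + 2 < p ∧ p ≤ 6 * q := by
  by_contra! hno
  have hle := pow_le_of_forall_prime (show 0 < q by omega) hno
  set s := Nat.sqrt (6 * q) with hs
  have hs1 : s ^ 2 ≤ 6 * q := Nat.sqrt_le' _
  have hs2 : 6 * q ≤ (s + 1) ^ 2 := (Nat.lt_succ_sqrt' _).le
  have hs3 : 300 ≤ s := Nat.le_sqrt'.2 (by omega)
  have hs3' : (300 : ℝ) ≤ s := by exact_mod_cast hs3
  have hq0 : (0 : ℝ) < q := by exact_mod_cast (show 0 < q by omega)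
  have hs1' : (s : ℝ) ^ 2 ≤ 6 * q := by exact_mod_cast hs1
  have hs2' : (6 * q : ℝ) ≤ ((s : ℝ) + 1) ^ 2 := by exact_mod_cast hs2
  have hle' : (27 : ℝ) ^ q ≤ 16 ^ q * (6 * q) ^ (2 * s + 4) := by exact_mod_cast hle
  have hlog := Real.log_le_log (by positivity) hle'
  rw [Real.log_mul (by positivity) (by positivity), Real.log_pow, Real.log_pow, Real.log_pow]
    at hlog
  have h27 : 4 * Real.log 27 ≥ 19 * Real.log 2 := by
    have := Real.log_le_log (by norm_num) (show (2 : ℝ) ^ 19 ≤ 27 ^ 4 by norm_num)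
    rw [Real.log_pow, Real.log_pow] at this
    exact_mod_cast this
  have h16 : Real.log 16 = 4 * Real.log 2 := by
    rw [show (16 : ℝ) = 2 ^ 4 by norm_num, Real.log_pow]; norm_num
  have h6q : Real.log (6 * q) ≤ 2 * Real.log (s + 1) := by
    have := Real.log_le_log (by positivity) hs2'
    rwa [Real.log_pow, Nat.cast_ofNat] at this
  have htan : Real.log (s + 1) ≤ 8 * Real.log 2 + (s + 1) / 256 - 1 := by
    have := Real.log_le_sub_one_of_pos (show (0 : ℝ) < (s + 1) / 256 by positivity)
    rw [Real.log_div (by positivity) (by norm_num), show (256 : ℝ) = 2 ^ 8 by norm_num,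
      Real.log_pow] at this
    norm_num at this ⊢
    linarith
  have hlog2 := Real.log_two_gt_d9
  have hlog2' := Real.log_two_lt_d9
  push_cast at hlog
  have hup : Real.log (6 * q) ≤ 2 * (4.5456 + (s + 1) / 256) := by linarith
  have hlow : (0.5197 : ℝ) * q ≤ q * (Real.log 27 - Real.log 16) := by
    rw [mul_comm]; gcongr; linarith
  have hmul : (2 * (s : ℝ) + 4) * Real.log (6 * q) ≤
      (2 * s + 4) * (2 * (4.5456 + (s + 1) / 256)) := by gcongr
  nlinarith

theorem exists_prime_between {m : ℕ} (hm : 2 ≤ m) : ∃ p, p.Prime ∧ 4 * m < 3 * p ∧ p ≤ 2 * m := by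
  by_cases hlarge : 45000 ≤ m
  · obtain ⟨p, hp, h1, h2⟩ := exists_prime_of_large (show 15000 ≤ m / 3 by omega)
    exact ⟨p, hp, by omega, by omega⟩
  by_contra! hno
  have := hno 65789 (by norm_num)
  have := hno 43867 (by norm_num)
  have := hno 29251 (by norm_num)
  have := hno 19507 (by norm_num)
  have := hno 13009 (by norm_num)
  have := hno 8681 (by norm_num)
  have := hno 5791 (by norm_num)
  have := hno 3863 (by norm_num)
  have := hno 2579 (by norm_num)
  have := hno 1723 (by norm_num)
  have := hno 1153 (by norm_num)
  have := hno 773 (by norm_num)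
  have := hno 523 (by norm_num)
  have := hno 349 (by norm_num)
  have := hno 233 (by norm_num)
  have := hno 157 (by norm_num)
  have := hno 107 (by norm_num)
  have := hno 71 (by norm_num)
  have := hno 47 (by norm_num)
  have := hno 31 (by norm_num)
  have := hno 23 (by norm_num)
  have := hno 17 (by norm_num)
  have := hno 11 (by norm_num)
  have := hno 7 (by norm_num)
  have := hno 5 (by norm_num)
  have := hno 3 (by norm_num)
  omega

/-- For every integer `m ≥ 2`, the central binomial coefficient `C(2m, m)` does not divide
`C(4m, 2m)`. -/
theorem stmt4 (m : ℕ) (hm : 2 ≤ m) :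
    ¬ (Nat.choose (2 * m) m ∣ Nat.choose (4 * m) (2 * m)) := by
  obtain ⟨p, hp, h1, h2⟩ := exists_prime_between hm
  exact not_choose_dvd_choose_of_prime hm hp h1 h2
end

section
/- Let n ≥ 1 be an integer. Then (n < 4 or n = 5) holds if and only if for every multiset {p_1,…,p_k} of positive integers with p_1 + ⋯ + p_k = n, the divisibility (Π_{i=1}^{k} (2p_i)!) · n! ∣ (2n)! · (Π_{i=1}^{k} p_i!) holds. -/
open Nat

/-- The divisibility for a multiset consisting of `m` copies of `q` and possibly one smaller
remainder, with the remainder cancelled. -/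
lemma pow_factorial_mul_dvd_of_forall_multiset {n m q : ℕ} (hq : 0 < q) (hmq : m * q ≤ n)
    (h : ∀ M : Multiset ℕ, (∀ p ∈ M, 0 < p) → M.sum = n →
      (M.map fun p => (2 * p)!).prod * n ! ∣ (2 * n)! * (M.map fun p => p !).prod) :
    (2 * q)! ^ m * n ! ∣ (2 * n)! * q ! ^ m := by
  obtain ⟨r, rfl⟩ := Nat.exists_eq_add_of_le hmq
  have key : ((2 * q)! ^ m * (m * q + r)!) * (2 * r)! ∣
      ((2 * (m * q + r))! * q ! ^ m) * r ! := by
    rcases Nat.eq_zero_or_pos r with rfl | hr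
    · simpa using h (Multiset.replicate m q)
        (fun p hp => (Multiset.eq_of_mem_replicate hp) ▸ hq) (by simp)
    · have := h (Multiset.replicate m q + {r}) (fun p hp => by
          rcases Multiset.mem_add.mp hp with hp | hp
          · exact (Multiset.eq_of_mem_replicate hp) ▸ hq
          · exact (Multiset.mem_singleton.mp hp) ▸ hr) (by simp)
      simp only [Multiset.map_add, Multiset.map_replicate, Multiset.map_singleton,
        Multiset.prod_add, Multiset.prod_replicate, Multiset.prod_singleton] at this
      rwa [mul_right_comm, ← mul_assoc] at this
  exact Nat.dvd_of_mul_dvd_mul_right (Nat.factorial_pos r)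
    ((Nat.mul_dvd_mul_left _ (Nat.factorial_dvd_factorial (by omega))).trans key)

lemma padicValNat_factorial_of_lt_sq {p n : ℕ} [Fact p.Prime] (h : n < p ^ 2) :
    padicValNat p n ! = n / p := by
  rw [padicValNat_factorial (Nat.log_lt_of_lt_pow' two_ne_zero h)]
  simp

/-- If `m` copies of `q` fit into `n`, and the prime `2 * q - 1` divides `(2 * n)! / n !` fewer
than `m` times, the divisibility fails for some multiset. -/
lemma not_forall_multiset_of_prime {n : ℕ} (m q : ℕ) (hp : (2 * q - 1).Prime) (hq : 2 ≤ q)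
    (hmq : m * q ≤ n) (hn : 2 * n < (2 * q - 1) ^ 2)
    (hm : 2 * n / (2 * q - 1) < m + n / (2 * q - 1)) :
    ¬ ∀ M : Multiset ℕ, (∀ p ∈ M, 0 < p) → M.sum = n →
      (M.map fun p => (2 * p)!).prod * n ! ∣ (2 * n)! * (M.map fun p => p !).prod := by
  intro h
  have hdvd := pow_factorial_mul_dvd_of_forall_multiset (by omega) hmq h
  generalize hpq : 2 * q - 1 = p at *
  have : Fact p.Prime := ⟨hp⟩
  have hle := (padicValNat_dvd_iff_le (p := p) (by positivity)).mp
    ((pow_padicValNat_dvd (p := p)).trans hdvd)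
  have h2q : 1 ≤ padicValNat p (2 * q)! :=
    one_le_padicValNat_of_dvd (by positivity) (hp.dvd_factorial.mpr (by omega))
  have hq0 : padicValNat p q ! = 0 :=
    padicValNat.eq_zero_of_not_dvd fun hd => by have := hp.dvd_factorial.mp hd; omega
  rw [padicValNat.mul (by positivity) (by positivity),
    padicValNat.mul (by positivity) (by positivity), padicValNat.pow, padicValNat.pow, hq0,
    padicValNat_factorial_of_lt_sq hn,
    padicValNat_factorial_of_lt_sq (n := n) (by omega)] at hle
  nlinarith [Nat.mul_le_mul_left m h2q]

lemma not_forall_multiset_of_le {n : ℕ} (hn : 15 ≤ n) :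
    ¬ ∀ M : Multiset ℕ, (∀ p ∈ M, 0 < p) → M.sum = n →
      (M.map fun p => (2 * p)!).prod * n ! ∣ (2 * n)! * (M.map fun p => p !).prod := by
  obtain ⟨p, hp, hlt, hle⟩ := Nat.exists_prime_lt_and_le_two_mul (n / 3) (by omega)
  obtain ⟨k, rfl⟩ : Odd p := hp.odd_of_ne_two (by omega)
  have hpk : 2 * (k + 1) - 1 = 2 * k + 1 := by omega
  have hsq : 2 * n < (2 * (k + 1) - 1) ^ 2 := by
    rw [hpk]
    have : 6 ≤ 2 * k + 1 := by omega
    have := Nat.mul_le_mul_right (2 * k + 1) this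
    rw [pow_two]
    omega
  have hdiv : ∀ a b, a < (b + 1) * (2 * k + 1) → a / (2 * k + 1) ≤ b := fun a b h =>
    Nat.le_of_lt_succ (Nat.div_lt_of_lt_mul (by rwa [mul_comm]))
  have hdiv' : ∀ a b, b * (2 * k + 1) ≤ a → b ≤ a / (2 * k + 1) := fun a b h =>
    (Nat.le_div_iff_mul_le (by omega)).mpr h
  by_cases h5 : 2 * n < 5 * (2 * k + 1)
  · refine not_forall_multiset_of_prime 3 (k + 1) (hpk ▸ hp) (by omega) (by omega) hsq ?_
    rw [hpk]
    by_cases h4 : n < 2 * (2 * k + 1)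
    · have := hdiv (2 * n) 3 (by omega)
      have := hdiv' n 1 (by omega)
      omega
    · have := hdiv (2 * n) 4 (by omega)
      have := hdiv' n 2 (by omega)
      omega
  · refine not_forall_multiset_of_prime 4 (k + 1) (hpk ▸ hp) (by omega) (by omega) hsq ?_
    rw [hpk]
    by_cases h6 : n < 3 * (2 * k + 1)
    · have := hdiv (2 * n) 5 (by omega)
      have := hdiv' n 2 (by omega)
      omega
    · have := hdiv (2 * n) 6 (by omega)
      have := hdiv' n 3 (by omega)
      omega

lemma list_dvd_of_sum_eq {n : ℕ} (hn : n < 4 ∨ n = 5) (l : List ℕ) (hpos : ∀ p ∈ l, 0 < p)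
    (hsum : l.sum = n) :
    (l.map fun p => (2 * p)!).prod * n ! ∣ (2 * n)! * (l.map fun p => p !).prod := by
  rcases l with _ | ⟨a, _ | ⟨b, _ | ⟨c, _ | ⟨d, _ | ⟨e, _ | ⟨f, l⟩⟩⟩⟩⟩⟩ <;>
    simp only [List.mem_cons, forall_eq_or_imp, List.not_mem_nil, List.sum_cons,
      List.sum_nil] at hpos hsum <;>
    subst hsum
  · simp
  · simp [mul_comm]
  · obtain ⟨ha, hb, -⟩ := hpos
    have : a ≤ 4 := by omega
    have : b ≤ 4 := by omega
    interval_cases a <;> interval_cases b <;> first | omega | decide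
  · obtain ⟨ha, hb, hc, -⟩ := hpos
    have : a ≤ 3 := by omega
    have : b ≤ 3 := by omega
    have : c ≤ 3 := by omega
    interval_cases a <;> interval_cases b <;> interval_cases c <;> first | omega | decide
  · obtain ⟨ha, hb, hc, hd, -⟩ := hpos
    have : a ≤ 2 := by omega
    have : b ≤ 2 := by omega
    have : c ≤ 2 := by omega
    have : d ≤ 2 := by omega
    interval_cases a <;> interval_cases b <;> interval_cases c <;> interval_cases d <;>
      first | omega | decide
  · obtain ⟨ha, hb, hc, hd, he, -⟩ := hpos
    obtain ⟨rfl, rfl, rfl, rfl, rfl⟩ : a = 1 ∧ b = 1 ∧ c = 1 ∧ d = 1 ∧ e = 1 := by omega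
    decide
  · omega

lemma not_forall_multiset_eleven :
    ¬ ∀ M : Multiset ℕ, (∀ p ∈ M, 0 < p) → M.sum = 11 →
      (M.map fun p => (2 * p)!).prod * 11 ! ∣ (2 * 11)! * (M.map fun p => p !).prod := by
  intro h
  have := h {5, 6} (by simp) (by simp)
  revert this
  simp only [Multiset.insert_eq_cons, Multiset.map_cons, Multiset.map_singleton,
    Multiset.prod_cons, Multiset.prod_singleton]
  norm_num [Nat.factorial]

/-- The 2-divisible partition lattice `Π²_{2n}` is strongly coset-like iff `n < 4` or `n = 5`:
for `n ≥ 1`, `(n < 4 ∨ n = 5)` holds iff for every multiset `{p₁, …, p_k}` of positive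
integers with `p₁ + ⋯ + p_k = n` the divisibility
`(∏ (2pᵢ)!) · n! ∣ (2n)! · (∏ pᵢ!)` holds. -/
theorem stmt6 (n : ℕ) (hn : 1 ≤ n) :
    (n < 4 ∨ n = 5) ↔
      ∀ M : Multiset ℕ, (∀ p ∈ M, 0 < p) → M.sum = n →
        (M.map fun p => (2 * p)!).prod * n ! ∣ (2 * n)! * (M.map fun p => p !).prod := by
  refine ⟨fun h M hpos hsum => ?_, fun h => ?_⟩
  · induction M using Quotient.inductionOn with
    | _ l => simpa using list_dvd_of_sum_eq h l (by simpa using hpos) (by simpa using hsum)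
  · by_contra! hn'
    by_cases h15 : 15 ≤ n
    · exact not_forall_multiset_of_le h15 h
    obtain rfl | h11 := eq_or_ne n 11
    · exact not_forall_multiset_eleven h
    obtain rfl | h67 | h810 | h1214 :
        n = 4 ∨ (6 ≤ n ∧ n ≤ 7) ∨ (8 ≤ n ∧ n ≤ 10) ∨ (12 ≤ n ∧ n ≤ 14) := by omega
    · exact not_forall_multiset_of_prime 2 2 (by norm_num) (by omega) (by omega) (by omega)
        (by omega) h
    · exact not_forall_multiset_of_prime 2 3 (by norm_num) (by omega) (by omega) (by omega)
        (by omega) h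
    · exact not_forall_multiset_of_prime 2 4 (by norm_num) (by omega) (by omega) (by omega)
        (by omega) h
    · exact not_forall_multiset_of_prime 2 6 (by norm_num) (by omega) (by omega) (by omega)
        (by omega) h
end

section
/- For every integer d ≥ 2 there exists N = N(d) such that for all n ≥ N there exists a multiset {p_1,…,p_k} of positive integers with p_1 + ⋯ + p_k = n for which (Π_{i=1}^{k} (dp_i)!) · n! does not divide (dn)! · (Π_{i=1}^{k} p_i!). -/
open Nat

theorem Nat.Prime.pow_div_dvd_factorial {p : ℕ} (hp : p.Prime) (n : ℕ) : p ^ (n / p) ∣ n ! := by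
  have := Fact.mk hp
  rw [padicValNat_dvd_iff_le (factorial_ne_zero n), ← padicValNat_mul_div_factorial,
    padicValNat_factorial_mul]
  exact Nat.le_add_left _ _

theorem Nat.Prime.sub_one_mul_le_of_pow_dvd_factorial {p e n : ℕ} (hp : p.Prime)
    (h : p ^ e ∣ n !) : (p - 1) * e ≤ n := by
  have := Fact.mk hp
  rw [padicValNat_dvd_iff_le (factorial_ne_zero n)] at h
  calc (p - 1) * e ≤ (p - 1) * padicValNat p n ! := Nat.mul_le_mul_left _ h
    _ = n - (p.digits n).sum := sub_one_mul_padicValNat_factorial n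
    _ ≤ n := Nat.sub_le _ _

theorem mul_lt_sub_one_mul_div_add_div {d p m n : ℕ} (hmp : m ≤ p) (hdm : m * d ≤ p + d)
    (hm : d + 3 ≤ m) (hn : 2 * p * m * p ≤ n) : d * n < (p - 1) * (n / m + n / p) := by
  have hk : n < m * (n / m + 1) := Nat.lt_mul_div_succ n (by omega)
  have hq : n < p * (n / p + 1) := Nat.lt_mul_div_succ n (by omega)
  generalize n / m = k at *
  generalize n / p = q at *
  obtain ⟨s, rfl⟩ : ∃ s, p = s + 1 := ⟨p - 1, by omega⟩
  rw [Nat.add_sub_cancel]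
  by_contra! h
  zify at *
  have hs : (0 : ℤ) ≤ s := by positivity
  have hn0 : (0 : ℤ) ≤ n := by positivity
  have hm0 : (0 : ℤ) < m := by linarith [Int.natCast_nonneg d]
  have h1 := mul_le_mul_of_nonneg_left h (mul_nonneg hm0.le (by linarith : (0 : ℤ) ≤ s + 1))
  have h2 := mul_le_mul_of_nonneg_left hk.le (mul_nonneg hs (by linarith : (0 : ℤ) ≤ s + 1))
  have h3 := mul_le_mul_of_nonneg_left hq.le (mul_nonneg hs hm0.le)
  have h4 := mul_le_mul_of_nonneg_left hdm (mul_nonneg hn0 (by linarith : (0 : ℤ) ≤ s + 1))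
  have h5 := mul_le_mul_of_nonneg_left hm (mul_nonneg hn0 (by linarith : (0 : ℤ) ≤ s + 1))
  have h6 := mul_le_mul_of_nonneg_left hmp hn0
  nlinarith

/-- For every `d ≥ 2` there exists `N` such that for all `n ≥ N` the `d`-divisible partition
lattice `Π^d_{dn}` is not strongly coset-like: there is a multiset `{p₁, …, p_k}` of positive
integers with `p₁ + ⋯ + p_k = n` for which `(∏ (dpᵢ)!) · n!` does not divide
`(dn)! · (∏ pᵢ!)`. -/
theorem stmt7 (d : ℕ) (hd : 2 ≤ d) :
    ∃ N : ℕ, ∀ n : ℕ, N ≤ n →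
      ∃ M : Multiset ℕ, (∀ p ∈ M, 0 < p) ∧ M.sum = n ∧
        ¬ ((M.map fun p => (d * p)!).prod * n ! ∣ (d * n)! * (M.map fun p => p !).prod) := by
  obtain ⟨p, hpd, hp⟩ := Nat.exists_infinite_primes ((d + 2) * d)
  have hdp : d + 2 ≤ p / d := (Nat.le_div_iff_mul_le (by omega)).2 hpd
  have hp2 : p / d ≤ p / 2 := Nat.div_le_div_left hd (by norm_num)
  have hlt : p < d * (p / d + 1) := Nat.lt_mul_div_succ p (by omega)
  have hle : p / d * d ≤ p := Nat.div_mul_le_self p d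
  obtain ⟨m, hm⟩ : ∃ m, m = p / d + 1 := ⟨_, rfl⟩
  have hdm : m * d ≤ p + d := by rw [hm, add_mul]; omega
  rw [← hm] at hlt
  have hmp : m < p := by omega
  refine ⟨2 * p * m * p, fun n hn =>
    ⟨Multiset.replicate (n / m) m + Multiset.replicate (n % m) 1, ?_, ?_, ?_⟩⟩
  · intro x hx
    rcases Multiset.mem_add.1 hx with hx | hx <;> rw [Multiset.eq_of_mem_replicate hx] <;> omega
  · simp [Nat.div_add_mod']
  · intro h
    simp only [Multiset.map_add, Multiset.map_replicate, Multiset.prod_add,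
      Multiset.prod_replicate, factorial_one, one_pow, mul_one] at h
    have hcop : (p ^ (n / m + n / p)).Coprime (m ! ^ (n / m)) :=
      Nat.Coprime.pow _ _ ((hp.coprime_iff_not_dvd).2 fun h' => by
        have := hp.dvd_factorial.1 h'; omega)
    have hpow : p ^ (n / m + n / p) ∣ (d * n)! := by
      refine hcop.dvd_of_dvd_mul_right (dvd_trans ?_ h)
      rw [pow_add]
      exact mul_dvd_mul (dvd_mul_of_dvd_left (pow_dvd_pow_of_dvd (hp.dvd_factorial.2 hlt.le) _) _)
        (hp.pow_div_dvd_factorial n)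
    exact (mul_lt_sub_one_mul_div_add_div hmp.le hdm (by omega) hn).not_ge
      (hp.sub_one_mul_le_of_pow_dvd_factorial hpow)
end
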